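/- Let (E, 𝓛, 𝓑) be a weakly left-resolving labeled space, let {p_A : A ∈ 𝓑}, {s_a : a ∈ 𝒜} be a representation of (E, 𝓛, 𝓑) in a C*-algebra, and let D be the C*-subalgebra generated by {p_A : A ∈ 𝓑} ∪ {s_a : a ∈ 𝒜}. Let 𝓗 be a hereditary subset of 𝓑 such that for every a ∈ 𝒜, either s(a) ∈ 𝓗 or s(a) ∩ A = ∅ for all A ∈ 𝓗. Then I := the closure of span{s_α p_A s_β* : α, β ∈ 𝓛^#(E), A ∈ 𝓗} is a closed two-sided ideal of D. -/

import Mathlib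

universe u v w

/-- A labeled graph: a directed graph with source and range maps together with a
labeling of the edges by an alphabet `Λ` (onto, i.e. `Λ = 𝓛(E¹)`). -/
structure LabeledGraph (V : Type u) (E : Type v) (Λ : Type w) where
  src : E → V
  rng : E → V
  lab : E → Λ
  lab_surj : Function.Surjective lab

namespace LabeledGraph

variable {V : Type u} {E : Type v} {Λ : Type w} (G : LabeledGraph V E Λ)

/-- A (finite, nonempty) path: a nonempty list of composable edges. -/
def IsPath (p : List E) : Prop :=
  p ≠ [] ∧ p.Chain' (fun e f => G.rng e = G.src f)

/-- The relative range `r(A, α)`. -/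
def relRange (A : Set V) (α : List Λ) : Set V :=
  {v | ∃ p : List E, G.IsPath p ∧ p.map G.lab = α ∧
      (∃ e, p.head? = some e ∧ G.src e ∈ A) ∧
      (∃ e, p.getLast? = some e ∧ G.rng e = v)}

/-- The range `r(α) = r(E⁰, α)`. -/
def range (α : List Λ) : Set V := G.relRange Set.univ α

/-- The source set `s(α)` of a word. -/
def srcSet (α : List Λ) : Set V :=
  {v | ∃ p : List E, G.IsPath p ∧ p.map G.lab = α ∧
      (∃ e, p.head? = some e ∧ G.src e = v)}

/-- `𝓛(A E¹)`: the labels of edges with source in `A`. -/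
def labelSet (A : Set V) : Set Λ :=
  {a | ∃ e, G.src e ∈ A ∧ G.lab e = a}

/-- `𝓛*(E)`: the labels of finite nonempty paths. -/
def words : Set (List Λ) :=
  {α | ∃ p : List E, G.IsPath p ∧ p.map G.lab = α}

/-- `𝓛^#(E) = 𝓛*(E) ∪ {ε}`. -/
def wordsHash : Set (List Λ) := insert [] G.words

/-- The set of sinks `E⁰_sink`. -/
def sinks : Set V := {v | ∀ e : E, G.src e ≠ v}

/-- `ℬ ⊆ 2^{E⁰}` is accommodating. -/
structure Accommodating (ℬ : Set (Set V)) : Prop where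
  nonempty : ∃ A ∈ ℬ, A ≠ ∅
  range_mem : ∀ α ∈ G.words, G.range α ∈ ℬ
  relRange_mem : ∀ A ∈ ℬ, ∀ α ∈ G.words, G.relRange A α ∈ ℬ
  inter_mem : ∀ A ∈ ℬ, ∀ B ∈ ℬ, A ∩ B ∈ ℬ
  union_mem : ∀ A ∈ ℬ, ∀ B ∈ ℬ, A ∪ B ∈ ℬ

/-- `(E, 𝓛, ℬ)` is weakly left-resolving. -/
def WeaklyLeftResolving (ℬ : Set (Set V)) : Prop :=
  ∀ A ∈ ℬ, ∀ B ∈ ℬ, ∀ α ∈ G.words,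
    G.relRange (A ∩ B) α = G.relRange A α ∩ G.relRange B α

/-- `ℬ` is closed under relative complements (non-degeneracy). -/
def NonDegenerate (_G : LabeledGraph V E Λ) (ℬ : Set (Set V)) : Prop :=
  ∀ A ∈ ℬ, ∀ B ∈ ℬ, A \ B ∈ ℬ

/-- A hereditary subset `ℋ` of `ℬ` (not containing `∅`). -/
structure Hereditary (ℬ ℋ : Set (Set V)) : Prop where
  subset : ℋ ⊆ ℬ
  empty_not_mem : ∅ ∉ ℋ
  relRange_mem : ∀ A ∈ ℋ, ∀ α ∈ G.words, G.relRange A α ≠ ∅ → G.relRange A α ∈ ℋ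
  union_mem : ∀ A ∈ ℋ, ∀ B ∈ ℋ, A ∪ B ∈ ℋ
  mem_of_subset : ∀ A ∈ ℋ, ∀ B ∈ ℬ, B ≠ ∅ → B ⊆ A → B ∈ ℋ

/-- A minimal sinks set. -/
def MinimalSinksSet (ℬ : Set (Set V)) (A : Set V) : Prop :=
  A ∈ ℬ ∧ A.Nonempty ∧ A ⊆ G.sinks ∧ ∀ B ∈ ℬ, A ⊆ B ∨ A ∩ B = ∅

end LabeledGraph

/-- A representation of the labeled space `(E, 𝓛, ℬ)` in a C*-algebra `B`. -/
structure LabeledSpaceRep {V : Type u} {E : Type v} {Λ : Type w}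
    (G : LabeledGraph V E Λ) (ℬ : Set (Set V))
    (B : Type*) [CStarAlgebra B] where
  p : Set V → B
  s : Λ → B
  p_empty : p ∅ = 0
  p_selfAdjoint : ∀ A ∈ ℬ, star (p A) = p A
  s_partialIsometry : ∀ a : Λ, s a * star (s a) * s a = s a
  p_inter : ∀ A ∈ ℬ, ∀ A' ∈ ℬ, p A * p A' = p (A ∩ A')
  p_union : ∀ A ∈ ℬ, ∀ A' ∈ ℬ, p (A ∪ A') = p A + p A' - p (A ∩ A')
  s_star_s : ∀ a b : Λ, star (s a) * s b = open Classical in if a = b then p (G.range [a]) else 0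

  s_star_p : ∀ a : Λ, ∀ A ∈ ℬ, star (s a) * p A = p (G.relRange A [a]) * star (s a)
  p_sum : ∀ A ∈ ℬ, ∀ hfin : (G.labelSet A).Finite, A ∩ G.sinks = ∅ →
      p A = ∑ a ∈ hfin.toFinset, s a * p (G.relRange A [a]) * star (s a)

namespace LabeledSpaceRep

variable {V : Type u} {E : Type v} {Λ : Type w}
  {G : LabeledGraph V E Λ} {ℬ : Set (Set V)}
  {B : Type*} [CStarAlgebra B]

/-- `s_μ = s_{a₁} ⋯ s_{aₙ}` for a word `μ = a₁ ⋯ aₙ`; `s_ε = 1`. -/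
def sWord (ρ : LabeledSpaceRep G ℬ B) (μ : List Λ) : B := (μ.map ρ.s).prod

end LabeledSpaceRep

namespace LabeledGraph

variable {V : Type u} {E : Type v} {Λ : Type w} (G : LabeledGraph V E Λ)

theorem singleton_mem_words (a : Λ) : [a] ∈ G.words := by
  obtain ⟨e, rfl⟩ := G.lab_surj a
  exact ⟨[e], ⟨by simp, List.isChain_singleton e⟩, rfl⟩

theorem mem_relRange_singleton {A : Set V} {a : Λ} {v : V} :
    v ∈ G.relRange A [a] ↔ ∃ e, G.lab e = a ∧ G.src e ∈ A ∧ G.rng e = v := by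
  constructor
  · rintro ⟨p, -, hl, ⟨e, he, hA⟩, f, hf, rfl⟩
    obtain ⟨g, rfl, rfl⟩ := List.map_eq_singleton_iff.1 hl
    simp only [List.head?_cons, List.getLast?_singleton, Option.some.injEq] at he hf
    subst he hf
    exact ⟨g, rfl, hA, rfl⟩
  · rintro ⟨e, rfl, hA, rfl⟩
    exact ⟨[e], ⟨by simp, List.isChain_singleton e⟩, rfl, ⟨e, rfl, hA⟩, e, rfl, rfl⟩

/-- The relative range obtained by following the letters of a word one at a time. -/
def iterRange (A : Set V) (α : List Λ) : Set V :=
  α.foldl (fun C a => G.relRange C [a]) A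

theorem exists_path_of_mem_iterRange {A : Set V} {α : List Λ} (hα : α ≠ []) {v : V}
    (hv : v ∈ G.iterRange A α) :
    ∃ p : List E, G.IsPath p ∧ p.map G.lab = α ∧ ∃ e, p.getLast? = some e ∧ G.rng e = v := by
  induction α using List.reverseRecOn generalizing v with
  | nil => exact absurd rfl hα
  | append_singleton α a ih =>
    rw [iterRange, List.foldl_append, List.foldl_cons, List.foldl_nil,
      mem_relRange_singleton] at hv
    obtain ⟨f, rfl, hf, rfl⟩ := hv
    rcases eq_or_ne α [] with rfl | hne
    · exact ⟨[f], ⟨by simp, List.isChain_singleton f⟩, rfl, f, rfl, rfl⟩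
    · obtain ⟨p, hp, rfl, e, he, hef⟩ := ih hne hf
      refine ⟨p ++ [f], ⟨by simp, ?_⟩, by simp, f, by simp, rfl⟩
      refine List.isChain_append.2 ⟨hp.2, List.isChain_singleton f, ?_⟩
      rintro x hx y hy
      simp only [he, Option.mem_some_iff, List.head?_cons] at hx hy
      rw [← hx, ← hy, hef]

theorem iterRange_eq_empty {A : Set V} {α : List Λ} (hα : α ∉ G.wordsHash) :
    G.iterRange A α = ∅ := by
  refine Set.eq_empty_of_forall_notMem fun v hv => hα ?_
  rcases eq_or_ne α [] with rfl | hne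
  · exact Set.mem_insert _ _
  · obtain ⟨p, hp, hl, -⟩ := G.exists_path_of_mem_iterRange hne hv
    exact Set.mem_insert_of_mem _ ⟨p, hp, hl⟩

variable {G} in
theorem Accommodating.iterRange_mem {ℬ : Set (Set V)} (h : G.Accommodating ℬ) {A : Set V}
    (hA : A ∈ ℬ) (α : List Λ) : G.iterRange A α ∈ ℬ := by
  induction α generalizing A with
  | nil => exact hA
  | cons a α ih => exact ih (h.relRange_mem A hA _ (G.singleton_mem_words a))

end LabeledGraph

namespace LabeledSpaceRep

variable {V : Type u} {E : Type v} {Λ : Type w}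
  {G : LabeledGraph V E Λ} {ℬ ℋ : Set (Set V)}
  {B : Type*} [CStarAlgebra B] (ρ : LabeledSpaceRep G ℬ B)

theorem sWord_nil : ρ.sWord [] = 1 := rfl

theorem sWord_cons (a : Λ) (α : List Λ) : ρ.sWord (a :: α) = ρ.s a * ρ.sWord α := by
  simp [sWord]

theorem sWord_append_singleton (α : List Λ) (a : Λ) :
    ρ.sWord (α ++ [a]) = ρ.sWord α * ρ.s a := by
  simp [sWord]

theorem p_mul_s (hacc : G.Accommodating ℬ) {A : Set V} (hA : A ∈ ℬ) (a : Λ) :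
    ρ.p A * ρ.s a = ρ.s a * ρ.p (G.relRange A [a]) := by
  have h := congrArg star (ρ.s_star_p a A hA)
  rwa [star_mul, star_mul, star_star, ρ.p_selfAdjoint A hA,
    ρ.p_selfAdjoint _ (hacc.relRange_mem A hA _ (G.singleton_mem_words a))] at h

theorem p_mul_sWord (hacc : G.Accommodating ℬ) {A : Set V} (hA : A ∈ ℬ) (α : List Λ) :
    ρ.p A * ρ.sWord α = ρ.sWord α * ρ.p (G.iterRange A α) := by
  induction α generalizing A with
  | nil => simp [sWord_nil, LabeledGraph.iterRange]
  | cons a α ih =>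
    rw [sWord_cons, ← mul_assoc, ρ.p_mul_s hacc hA, mul_assoc,
      ih (hacc.relRange_mem A hA _ (G.singleton_mem_words a)), ← mul_assoc]
    rfl

theorem s_mul_p_range (a : Λ) : ρ.s a * ρ.p (G.range [a]) = ρ.s a := by
  have h := ρ.s_star_s a a
  rw [if_pos rfl] at h
  rw [← h, ← mul_assoc, ρ.s_partialIsometry]

theorem sWord_eq_zero (hacc : G.Accommodating ℬ) {α : List Λ} (hα : α ∉ G.wordsHash) :
    ρ.sWord α = 0 := by
  cases α with
  | nil => exact absurd (Set.mem_insert _ _) hα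
  | cons a α =>
    have hempty : G.iterRange (G.range [a]) α = ∅ :=
      G.iterRange_eq_empty (A := Set.univ) hα
    rw [sWord_cons, ← ρ.s_mul_p_range a, mul_assoc,
      ρ.p_mul_sWord hacc (hacc.range_mem _ (G.singleton_mem_words a)), hempty, ρ.p_empty,
      mul_zero, mul_zero]

/-- The linear span of the elements `s_α p_A s_β*` with `A ∈ ℋ`. -/
noncomputable def idealSpan (ℋ : Set (Set V)) : Submodule ℂ B :=
  Submodule.span ℂ {x : B | ∃ α ∈ G.wordsHash, ∃ β ∈ G.wordsHash, ∃ A ∈ ℋ,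
    x = ρ.sWord α * ρ.p A * star (ρ.sWord β)}

theorem mem_idealSpan (hacc : G.Accommodating ℬ) {A : Set V} (hA : A ≠ ∅ → A ∈ ℋ)
    (α β : List Λ) : ρ.sWord α * ρ.p A * star (ρ.sWord β) ∈ ρ.idealSpan ℋ := by
  by_cases hα : α ∈ G.wordsHash
  · by_cases hβ : β ∈ G.wordsHash
    · by_cases hne : A = ∅
      · simp [hne, ρ.p_empty]
      · exact Submodule.subset_span ⟨α, hα, β, hβ, A, hA hne, rfl⟩
    · simp [ρ.sWord_eq_zero hacc hβ]
  · simp [ρ.sWord_eq_zero hacc hα]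

theorem mul_mem_idealSpan_of_generators {d : B}
    (h : ∀ A ∈ ℋ, ∀ α β, d * (ρ.sWord α * ρ.p A * star (ρ.sWord β)) ∈ ρ.idealSpan ℋ)
    {x : B} (hx : x ∈ ρ.idealSpan ℋ) : d * x ∈ ρ.idealSpan ℋ := by
  refine (Submodule.span_le (p := (ρ.idealSpan ℋ).comap (LinearMap.mulLeft ℂ d))).2 ?_ hx
  rintro _ ⟨α, -, β, -, A, hA, rfl⟩
  exact h A hA α β

theorem p_mul_sWord_mul_p_mem (hacc : G.Accommodating ℬ) (hher : G.Hereditary ℬ ℋ)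
    {C A : Set V} (hC : C ∈ ℬ) (hA : A ∈ ℋ) (α β : List Λ) :
    ρ.p C * (ρ.sWord α * ρ.p A * star (ρ.sWord β)) ∈ ρ.idealSpan ℋ := by
  have hR := hacc.iterRange_mem hC α
  have hAℬ := hher.subset hA
  rw [← mul_assoc, ← mul_assoc, ρ.p_mul_sWord hacc hC, mul_assoc (ρ.sWord α),
    ρ.p_inter _ hR _ hAℬ]
  exact ρ.mem_idealSpan hacc
    (fun hne => hher.mem_of_subset A hA _ (hacc.inter_mem _ hR _ hAℬ) hne Set.inter_subset_right)
    α β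

theorem star_mem_idealSpan (hsub : ℋ ⊆ ℬ) {x : B} (hx : x ∈ ρ.idealSpan ℋ) :
    star x ∈ ρ.idealSpan ℋ := by
  induction hx using Submodule.span_induction with
  | mem x hx =>
    obtain ⟨α, hα, β, hβ, A, hA, rfl⟩ := hx
    refine Submodule.subset_span ⟨β, hβ, α, hα, A, hA, ?_⟩
    simp [ρ.p_selfAdjoint A (hsub hA), mul_assoc]
  | zero => simp
  | add x y _ _ hx hy => simpa using add_mem hx hy
  | smul c x _ hx => simpa using Submodule.smul_mem _ (star c) hx

theorem p_mul_mem_idealSpan (hacc : G.Accommodating ℬ) (hher : G.Hereditary ℬ ℋ)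
    {C : Set V} (hC : C ∈ ℬ) {x : B} (hx : x ∈ ρ.idealSpan ℋ) : ρ.p C * x ∈ ρ.idealSpan ℋ :=
  ρ.mul_mem_idealSpan_of_generators
    (fun _ hA α β => ρ.p_mul_sWord_mul_p_mem hacc hher hC hA α β) hx

theorem s_mul_mem_idealSpan (hacc : G.Accommodating ℬ) (a : Λ) {x : B}
    (hx : x ∈ ρ.idealSpan ℋ) : ρ.s a * x ∈ ρ.idealSpan ℋ := by
  refine ρ.mul_mem_idealSpan_of_generators (fun A hA α β => ?_) hx
  rw [← mul_assoc, ← mul_assoc, ← sWord_cons]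
  exact ρ.mem_idealSpan hacc (fun _ => hA) _ _

theorem star_s_mul_mem_idealSpan (hacc : G.Accommodating ℬ) (hher : G.Hereditary ℬ ℋ)
    (a : Λ) {x : B} (hx : x ∈ ρ.idealSpan ℋ) : star (ρ.s a) * x ∈ ρ.idealSpan ℋ := by
  refine ρ.mul_mem_idealSpan_of_generators (fun A hA α β => ?_) hx
  cases α with
  | nil =>
    have h := ρ.mem_idealSpan hacc
      (hher.relRange_mem A hA [a] (G.singleton_mem_words a)) [] (β ++ [a])
    rwa [sWord_append_singleton, star_mul, sWord_nil, one_mul, ← mul_assoc,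
      ← ρ.s_star_p a A (hher.subset hA), mul_assoc, ← one_mul (ρ.p A), ← sWord_nil] at h
  | cons b α =>
    have hrw : star (ρ.s a) * (ρ.sWord (b :: α) * ρ.p A * star (ρ.sWord β)) =
        star (ρ.s a) * ρ.s b * (ρ.sWord α * ρ.p A * star (ρ.sWord β)) := by
      simp only [sWord_cons, mul_assoc]
    rw [hrw, ρ.s_star_s]
    split_ifs
    · exact ρ.p_mul_sWord_mul_p_mem hacc hher
        (hacc.range_mem _ (G.singleton_mem_words a)) hA α β
    · simp

theorem mul_mem_idealSpan_of_mem_adjoin (hacc : G.Accommodating ℬ) (hher : G.Hereditary ℬ ℋ)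
    {d : B} (hd : d ∈ NonUnitalStarAlgebra.adjoin ℂ
      ({x | ∃ A ∈ ℬ, x = ρ.p A} ∪ Set.range ρ.s)) :
    ∀ x ∈ ρ.idealSpan ℋ, d * x ∈ ρ.idealSpan ℋ ∧ x * d ∈ ρ.idealSpan ℋ := by
  have hstar {x : B} (hx : x ∈ ρ.idealSpan ℋ) := ρ.star_mem_idealSpan hher.subset hx
  induction hd using NonUnitalStarAlgebra.adjoin_induction with
  | mem d hd =>
    intro x hx
    rcases hd with ⟨A, hA, rfl⟩ | ⟨a, rfl⟩
    · refine ⟨ρ.p_mul_mem_idealSpan hacc hher hA hx, ?_⟩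
      simpa [ρ.p_selfAdjoint A hA] using hstar (ρ.p_mul_mem_idealSpan hacc hher hA (hstar hx))
    · refine ⟨ρ.s_mul_mem_idealSpan hacc a hx, ?_⟩
      simpa using hstar (ρ.star_s_mul_mem_idealSpan hacc hher a (hstar hx))
  | add c d _ _ hc hd =>
    intro x hx
    rw [add_mul, mul_add]
    exact ⟨add_mem (hc x hx).1 (hd x hx).1, add_mem (hc x hx).2 (hd x hx).2⟩
  | zero => simp
  | mul c d _ _ hc hd =>
    intro x hx
    rw [mul_assoc, ← mul_assoc x]
    exact ⟨(hc _ (hd x hx).1).1, (hd _ (hc x hx).2).2⟩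
  | smul r d _ hd =>
    intro x hx
    rw [smul_mul_assoc, mul_smul_comm]
    exact ⟨Submodule.smul_mem _ r (hd x hx).1, Submodule.smul_mem _ r (hd x hx).2⟩
  | star d _ hd =>
    intro x hx
    have h := hd _ (hstar hx)
    exact ⟨by simpa using hstar h.2, by simpa using hstar h.1⟩

theorem idealSpan_le_adjoin (hsub : ℋ ⊆ ℬ) {x : B} (hx : x ∈ ρ.idealSpan ℋ) :
    x ∈ NonUnitalStarAlgebra.adjoin ℂ ({x | ∃ A ∈ ℬ, x = ρ.p A} ∪ Set.range ρ.s) := by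
  set S := NonUnitalStarAlgebra.adjoin ℂ ({x | ∃ A ∈ ℬ, x = ρ.p A} ∪ Set.range ρ.s)
  have hgen : ({x | ∃ A ∈ ℬ, x = ρ.p A} ∪ Set.range ρ.s) ⊆ (S : Set B) :=
    NonUnitalStarAlgebra.subset_adjoin ℂ _
  have hmul (α : List Λ) {y : B} (hy : y ∈ S) : ρ.sWord α * y ∈ S := by
    induction α with
    | nil => simpa [sWord_nil] using hy
    | cons a α ih =>
      rw [sWord_cons, mul_assoc]
      exact mul_mem (hgen (Or.inr ⟨a, rfl⟩)) ih
  induction hx using Submodule.span_induction with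
  | mem x hx =>
    obtain ⟨α, -, β, -, A, hA, rfl⟩ := hx
    have h := hmul β (star_mem (hmul α (hgen (Or.inl ⟨A, hsub hA, rfl⟩))))
    simpa using star_mem h
  | zero => exact zero_mem S
  | add x y _ _ hx hy => exact add_mem hx hy
  | smul c x _ hx => exact SMulMemClass.smul_mem c hx

end LabeledSpaceRep

theorem stmt10 {V : Type u} {E : Type v} {Λ : Type w}
    (G : LabeledGraph V E Λ) (ℬ ℋ : Set (Set V))
    (hacc : G.Accommodating ℬ) (hwlr : G.WeaklyLeftResolving ℬ)
    {B : Type*} [CStarAlgebra B] (ρ : LabeledSpaceRep G ℬ B)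
    (hher : G.Hereditary ℬ ℋ)
    (hsrc : ∀ a : Λ, G.srcSet [a] ∈ ℋ ∨ ∀ A ∈ ℋ, G.srcSet [a] ∩ A = ∅)
    (D : Set B)
    (hD : D = closure (↑(NonUnitalStarAlgebra.adjoin ℂ
        ({x | ∃ A ∈ ℬ, x = ρ.p A} ∪ Set.range ρ.s)) : Set B))
    (I : Submodule ℂ B)
    (hI : I = (Submodule.span ℂ {x : B | ∃ α ∈ G.wordsHash, ∃ β ∈ G.wordsHash, ∃ A ∈ ℋ,
        x = ρ.sWord α * ρ.p A * star (ρ.sWord β)}).topologicalClosure) :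
    (↑I ⊆ D) ∧ ∀ d ∈ D, ∀ x ∈ I, d * x ∈ I ∧ x * d ∈ I := by
  subst hD
  change I = (ρ.idealSpan ℋ).topologicalClosure at hI
  subst hI
  refine ⟨closure_mono fun x hx => ρ.idealSpan_le_adjoin hher.subset hx, fun d hd x hx => ?_⟩
  constructor
  · exact map_mem_closure₂ continuous_mul hd hx fun c hc y hy =>
      (ρ.mul_mem_idealSpan_of_mem_adjoin hacc hher hc y hy).1
  · exact map_mem_closure₂ continuous_mul hx hd fun y hy c hc =>
      (ρ.mul_mem_idealSpan_of_mem_adjoin hacc hher hc y hy).2
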